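/- Monotonicity of the mixed convex roof CMI under tracing out part of A: if ρ is a density matrix on H_A ⊗ H_{A'} ⊗ H_B ⊗ H_C ⊗ H_E, then I⊔_{A:C|B}(Tr_{A'} ρ) ≤ I⊔_{AA':C|B}(ρ). -/

import Mathlib

open scoped ComplexOrder
open Kronecker Matrix

open Classical in
/-- The von Neumann entropy of a matrix, via the eigenvalues of its Hermitian part
(defined to be 0 on non-Hermitian matrices). -/
noncomputable def vnEntropy {n : Type*} [Fintype n] [DecidableEq n] (ρ : Matrix n n ℂ) : ℝ :=
  if h : ρ.IsHermitian then -∑ i, h.eigenvalues i * Real.log (h.eigenvalues i) else 0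

/-- A density matrix: positive semidefinite with unit trace. -/
def IsDensity {n : Type*} [Fintype n] (ρ : Matrix n n ℂ) : Prop :=
  ρ.PosSemidef ∧ ρ.trace = 1

section
variable {A B C E : Type*} [Fintype A] [DecidableEq A] [Fintype B] [DecidableEq B]
  [Fintype C] [DecidableEq C] [Fintype E] [DecidableEq E]

/-- Reduced state on AB. -/
noncomputable def redAB (ρ : Matrix (A × B × C) (A × B × C) ℂ) : Matrix (A × B) (A × B) ℂ :=
  Matrix.of fun x y => ∑ c : C, ρ (x.1, x.2, c) (y.1, y.2, c)

/-- Reduced state on BC. -/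
noncomputable def redBC (ρ : Matrix (A × B × C) (A × B × C) ℂ) : Matrix (B × C) (B × C) ℂ :=
  Matrix.of fun x y => ∑ a : A, ρ (a, x.1, x.2) (a, y.1, y.2)

/-- Reduced state on B. -/
noncomputable def redB (ρ : Matrix (A × B × C) (A × B × C) ℂ) : Matrix B B ℂ :=
  Matrix.of fun x y => ∑ a : A, ∑ c : C, ρ (a, x, c) (a, y, c)

/-- The quantum conditional mutual information I(A:C|B) = S(AB) + S(BC) - S(B) - S(ABC). -/
noncomputable def CMI (ρ : Matrix (A × B × C) (A × B × C) ℂ) : ℝ :=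
  vnEntropy (redAB ρ) + vnEntropy (redBC ρ) - vnEntropy (redB ρ) - vnEntropy ρ

/-- Partial trace over the environment E. -/
noncomputable def ptraceE (ρ : Matrix (A × B × C × E) (A × B × C × E) ℂ) :
    Matrix (A × B × C) (A × B × C) ℂ :=
  Matrix.of fun x y => ∑ e : E, ρ (x.1, x.2.1, x.2.2, e) (y.1, y.2.1, y.2.2, e)

/-- The mixed convex roof conditional mutual information: the infimum over all finite
convex decompositions of ρ into density matrices of the average CMI of Tr_E of the pieces. -/
noncomputable def mcoCMI (ρ : Matrix (A × B × C × E) (A × B × C × E) ℂ) : ℝ :=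
  sInf {r : ℝ |
    ∃ (k : ℕ) (p : Fin k → ℝ) (τ : Fin k → Matrix (A × B × C × E) (A × B × C × E) ℂ),
      (∀ i, 0 ≤ p i) ∧ (∑ i, p i) = 1 ∧ (∀ i, IsDensity (τ i)) ∧
      ρ = ∑ i, p i • τ i ∧ r = ∑ i, p i * CMI (ptraceE (τ i))}

end

/-- Partial trace over the A' part of the composite region AA'. -/
noncomputable def ptraceA' {A A' B C E : Type*} [Fintype A'] 
    (ρ : Matrix ((A × A') × B × C × E) ((A × A') × B × C × E) ℂ) :
    Matrix (A × B × C × E) (A × B × C × E) ℂ :=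
  Matrix.of fun x y => ∑ a' : A', ρ ((x.1, a'), x.2) ((y.1, a'), y.2)

set_option linter.unusedSectionVars false
set_option linter.unusedSimpArgs false
namespace SSA
open Filter Topology

section gen
variable {n : Type*} [Fintype n] [DecidableEq n]

structure IsDiag (M U : Matrix n n ℂ) (p : n → ℝ) : Prop where
  eq : M = U * Matrix.diagonal (fun i => (p i : ℂ)) * Uᴴ
  l : U * Uᴴ = 1
  r : Uᴴ * U = 1

/-- variational functional -/
noncomputable def J (t : ℝ) (ρ σ Z : Matrix n n ℂ) : ℝ :=
  2 * (ρ * Z).trace.re - (σ * (Z * Zᴴ)).trace.re - t * (ρ * (Zᴴ * Z)).trace.re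

lemma J_expand {ρ σ U V : Matrix n n ℂ} {p q : n → ℝ} (h1 : IsDiag ρ U p) (h2 : IsDiag σ V q)
    (t : ℝ) (Z : Matrix n n ℂ) :
    J t ρ σ Z = ∑ j, ∑ i, (2 * p i * (star ((Vᴴ * U) j i) * (Vᴴ * Z * U) j i).re
      - (q j + t * p i) * ‖(Vᴴ * Z * U) j i‖ ^ 2) := by
  set D := Matrix.diagonal (fun i => (p i : ℂ)) with hD
  set Q := Matrix.diagonal (fun i => (q i : ℂ)) with hQ
  set w := Vᴴ * Z * U with hw
  set u := Vᴴ * U with hu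
  have e1 : (ρ * Z).trace = (D * (uᴴ * w)).trace := by
    have : uᴴ * w = Uᴴ * (Z * U) := by
      calc uᴴ * w = Uᴴ * ((V * Vᴴ) * (Z * U)) := by simp [hu, hw, Matrix.mul_assoc]
        _ = _ := by rw [h2.l, Matrix.one_mul]
    rw [this, h1.eq, Matrix.mul_assoc, Matrix.mul_assoc, Matrix.trace_mul_comm]
    simp only [Matrix.mul_assoc, hD, hQ]
  have e2 : (σ * (Z * Zᴴ)).trace = (Q * (w * wᴴ)).trace := by
    have : w * wᴴ = Vᴴ * (Z * (Zᴴ * V)) := by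
      calc w * wᴴ = Vᴴ * (Z * ((U * Uᴴ) * (Zᴴ * V))) := by simp [hw, Matrix.mul_assoc]
        _ = _ := by rw [h1.l, Matrix.one_mul]
    rw [this, h2.eq, Matrix.mul_assoc, Matrix.mul_assoc, Matrix.trace_mul_comm]
    simp only [Matrix.mul_assoc, hD, hQ]
  have e3 : (ρ * (Zᴴ * Z)).trace = (D * (wᴴ * w)).trace := by
    have : wᴴ * w = Uᴴ * (Zᴴ * (Z * U)) := by
      calc wᴴ * w = Uᴴ * (Zᴴ * ((V * Vᴴ) * (Z * U))) := by simp [hw, Matrix.mul_assoc]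
        _ = _ := by rw [h2.l, Matrix.one_mul]
    rw [this, h1.eq, Matrix.mul_assoc, Matrix.mul_assoc, Matrix.trace_mul_comm]
    simp only [Matrix.mul_assoc, hD]
  have nsq : ∀ z : ℂ, ‖z‖ ^ 2 = (star z * z).re := by
    intro z; rw [← Complex.normSq_eq_norm_sq, Complex.normSq_apply]; simp
  have dD : ∀ (M : Matrix n n ℂ) i k, (D * M) i k = p i * M i k := fun M i k => Matrix.diagonal_mul _ _ _ _
  have dQ : ∀ (M : Matrix n n ℂ) i k, (Q * M) i k = q i * M i k := fun M i k => Matrix.diagonal_mul _ _ _ _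
  have f1 : (D * (uᴴ * w)).trace.re = ∑ j, ∑ i, p i * (star (u j i) * w j i).re := by
    rw [Finset.sum_comm]
    simp only [Matrix.trace, Matrix.diag, dD, dQ, Complex.re_sum,
      Complex.re_ofReal_mul, Matrix.mul_apply, Finset.mul_sum, Matrix.conjTranspose_apply]
  have f2 : (Q * (w * wᴴ)).trace.re = ∑ j, ∑ i, q j * ‖w j i‖ ^ 2 := by
    simp only [Matrix.trace, Matrix.diag, dD, dQ, Complex.re_sum, nsq,
      Complex.re_ofReal_mul, Matrix.mul_apply, Finset.mul_sum, Matrix.conjTranspose_apply, mul_comm (star _)]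
  have f3 : (D * (wᴴ * w)).trace.re = ∑ j, ∑ i, p i * ‖w j i‖ ^ 2 := by
    rw [Finset.sum_comm]
    simp only [Matrix.trace, Matrix.diag, dD, dQ, Complex.re_sum, nsq,
      Complex.re_ofReal_mul, Matrix.mul_apply, Finset.mul_sum, Matrix.conjTranspose_apply]
  rw [J, e1, e2, e3, f1, f2, f3]
  simp only [Finset.mul_sum, ← Finset.sum_sub_distrib]
  refine Finset.sum_congr rfl fun j _ => Finset.sum_congr rfl fun i _ => ?_
  ring

/-- value of the supremum -/
noncomputable def F (U V : Matrix n n ℂ) (p q : n → ℝ) (t : ℝ) : ℝ :=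
  ∑ j, ∑ i, ‖(Vᴴ * U) j i‖ ^ 2 * p i * (p i / (q j + t * p i))

lemma J_le {ρ σ U V : Matrix n n ℂ} {p q : n → ℝ} (h1 : IsDiag ρ U p) (h2 : IsDiag σ V q)
    (hp : ∀ i, 0 ≤ p i) (hq : ∀ i, 0 ≤ q i)
    {t : ℝ} (ht : 0 < t) (Z : Matrix n n ℂ) : J t ρ σ Z ≤ F U V p q t := by
  rw [J_expand h1 h2, F]
  refine Finset.sum_le_sum fun j _ => Finset.sum_le_sum fun i _ => ?_
  set u := (Vᴴ * U) j i
  set w := (Vᴴ * Z * U) j i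
  have hre : (star u * w).re ≤ ‖u‖ * ‖w‖ := by
    calc _ ≤ ‖star u * w‖ := Complex.re_le_norm _
      _ = _ := by rw [norm_mul, norm_star]
  rcases (hp i).eq_or_lt with h | h
  · rw [← h]; simp
    exact mul_nonneg (hq j) (sq_nonneg _)
  · have hd : 0 < q j + t * p i := add_pos_of_nonneg_of_pos (hq j) (mul_pos ht h)
    have key : ‖u‖ ^ 2 * p i * (p i / (q j + t * p i)) - (2 * p i * (‖u‖ * ‖w‖) - (q j + t * p i) * ‖w‖ ^ 2)
        = (p i * ‖u‖ - (q j + t * p i) * ‖w‖) ^ 2 / (q j + t * p i) := by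
      generalize q j + t * p i = d at hd
      field_simp; ring
    have k2 : 0 ≤ (p i * ‖u‖ - (q j + t * p i) * ‖w‖) ^ 2 / (q j + t * p i) := by positivity
    have k3 := mul_le_mul_of_nonneg_left hre (by positivity : 0 ≤ 2 * p i)
    linarith

lemma J_attain {ρ σ U V : Matrix n n ℂ} {p q : n → ℝ} (h1 : IsDiag ρ U p) (h2 : IsDiag σ V q)
    (hp : ∀ i, 0 ≤ p i) (hq : ∀ i, 0 ≤ q i)
    {t : ℝ} (ht : 0 < t) : ∃ Z, J t ρ σ Z = F U V p q t := by
  let w : Matrix n n ℂ := Matrix.of fun j i => ((p i / (q j + t * p i) : ℝ) : ℂ) * (Vᴴ * U) j i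
  refine ⟨V * w * Uᴴ, ?_⟩
  have hw : Vᴴ * (V * w * Uᴴ) * U = w := by
    calc _ = (Vᴴ * V) * w * (Uᴴ * U) := by simp only [Matrix.mul_assoc]
      _ = w := by rw [h2.r, h1.r]; simp
  rw [J_expand h1 h2, F, hw]
  refine Finset.sum_congr rfl fun j _ => Finset.sum_congr rfl fun i _ => ?_
  simp only [w, Matrix.of_apply]
  set u := (Vᴴ * U) j i
  have nsq : (star u * u) = ((‖u‖ ^ 2 : ℝ) : ℂ) := by
    rw [← Complex.normSq_eq_norm_sq, Complex.normSq_eq_conj_mul_self]; rfl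
  rw [mul_left_comm, nsq, ← Complex.ofReal_mul, Complex.ofReal_re, norm_mul, Complex.norm_real, mul_pow,
    Real.norm_eq_abs, sq_abs]
  rcases (hp i).eq_or_lt with h | h
  · rw [← h]; simp
  · have hd : 0 < q j + t * p i := add_pos_of_nonneg_of_pos (hq j) (mul_pos ht h)
    field_simp; ring

/-- weighted log sums -/
noncomputable def Hs (U V : Matrix n n ℂ) (p q : n → ℝ) (t : ℝ) : ℝ :=
  ∑ j, ∑ i, ‖(Vᴴ * U) j i‖ ^ 2 * p i * Real.log (q j + t * p i)

def Supp (U V : Matrix n n ℂ) (p q : n → ℝ) : Prop :=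
  ∀ j i, q j = 0 → ‖(Vᴴ * U) j i‖ ^ 2 * p i = 0

lemma Hs_deriv {U V : Matrix n n ℂ} {p q : n → ℝ}
    (hp : ∀ i, 0 ≤ p i) (hq : ∀ i, 0 ≤ q i) {t : ℝ} (ht : 0 < t) :
    HasDerivAt (Hs U V p q) (F U V p q t) t := by
  unfold Hs F
  refine HasDerivAt.fun_sum fun j _ => HasDerivAt.fun_sum fun i _ => ?_
  rcases (hp i).eq_or_lt with h | h
  · rw [← h]; simpa using hasDerivAt_const t (0:ℝ)
  · have hd : 0 < q j + t * p i := add_pos_of_nonneg_of_pos (hq j) (mul_pos ht h)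
    have := (((hasDerivAt_id t).mul_const (p i)).const_add (q j)).log hd.ne'
    simpa using this.const_mul (‖(Vᴴ * U) j i‖ ^ 2 * p i)

lemma Hs_zero {U V : Matrix n n ℂ} {p q : n → ℝ}
    (hs : Supp U V p q) :
    Tendsto (fun T : ℝ => Hs U V p q T⁻¹) atTop
      (𝓝 (∑ j, ∑ i, ‖(Vᴴ * U) j i‖ ^ 2 * p i * Real.log (q j))) := by
  unfold Hs
  refine tendsto_finsetSum _ fun j _ => tendsto_finsetSum _ fun i _ => ?_
  by_cases h : q j = 0
  · simp [hs j i h]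
  · refine Tendsto.const_mul _ (Tendsto.log ?_ h)
    simpa using (tendsto_inv_atTop_zero (𝕜 := ℝ)).mul_const (p i) |>.const_add (q j)

lemma Hs_top {U V : Matrix n n ℂ} {p q : n → ℝ}
    (hp : ∀ i, 0 ≤ p i) (hq : ∀ i, 0 ≤ q i) :
    Tendsto (fun T : ℝ => Hs U V p q T - Real.log T * ∑ j, ∑ i, ‖(Vᴴ * U) j i‖ ^ 2 * p i) atTop
      (𝓝 (∑ j, ∑ i, ‖(Vᴴ * U) j i‖ ^ 2 * p i * Real.log (p i))) := by
  unfold Hs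
  simp only [Finset.mul_sum, ← Finset.sum_sub_distrib]
  refine tendsto_finsetSum _ fun j _ => tendsto_finsetSum _ fun i _ => ?_
  rcases (hp i).eq_or_lt with h | h
  · rw [← h]; simp
  · have h1 : Tendsto (fun T : ℝ => ‖(Vᴴ * U) j i‖ ^ 2 * p i * Real.log (q j * T⁻¹ + p i)) atTop
      (𝓝 (‖(Vᴴ * U) j i‖ ^ 2 * p i * Real.log (p i))) := by
      refine Tendsto.const_mul _ (Tendsto.log ?_ h.ne')
      simpa using ((tendsto_inv_atTop_zero (𝕜 := ℝ)).const_mul (q j)).add_const (p i)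
    refine h1.congr' ?_
    filter_upwards [eventually_gt_atTop 0] with T hT
    have : q j * T⁻¹ + p i = (q j + T * p i) / T := by field_simp
    have hd : 0 < q j + T * p i := add_pos_of_nonneg_of_pos (hq j) (mul_pos hT h)
    rw [this, Real.log_div hd.ne' hT.ne']; ring

lemma unitary_col {U V : Matrix n n ℂ} (hU : Uᴴ * U = 1) (hV : V * Vᴴ = 1) (i : n) :
    ∑ j, ‖(Vᴴ * U) j i‖ ^ 2 = 1 := by
  have h : (Vᴴ * U)ᴴ * (Vᴴ * U) = 1 := by
    calc _ = Uᴴ * ((V * Vᴴ) * U) := by simp [Matrix.mul_assoc]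
      _ = 1 := by rw [hV, Matrix.one_mul, hU]
  have h2 := congrArg Complex.re (congrFun (congrFun h i) i)
  rw [Matrix.mul_apply, Complex.re_sum, Matrix.one_apply_eq, Complex.one_re] at h2
  rw [← h2]
  refine Finset.sum_congr rfl fun j _ => ?_
  rw [← Complex.normSq_eq_norm_sq, Complex.normSq_apply]; simp [Matrix.conjTranspose_apply]

lemma sum_fp {ρ σ U V : Matrix n n ℂ} {p q : n → ℝ} (h1 : IsDiag ρ U p) (h2 : IsDiag σ V q)
    (f : ℝ → ℝ) :
    ∑ j, ∑ i, ‖(Vᴴ * U) j i‖ ^ 2 * p i * f (p i) = ∑ i, p i * f (p i) := by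
  rw [Finset.sum_comm]
  refine Finset.sum_congr rfl fun i _ => ?_
  simp only [mul_assoc]
  rw [← Finset.sum_mul, unitary_col h1.r h2.l, one_mul]

lemma sum_p {ρ σ U V : Matrix n n ℂ} {p q : n → ℝ} (h1 : IsDiag ρ U p) (h2 : IsDiag σ V q) :
    ∑ j, ∑ i, ‖(Vᴴ * U) j i‖ ^ 2 * p i = ρ.trace.re := by
  have := sum_fp h1 h2 (fun _ => 1)
  simp only [mul_one] at this
  rw [this, h1.eq, Matrix.trace_mul_comm, ← Matrix.mul_assoc, h1.r, Matrix.one_mul]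
  simp [Matrix.trace]

/-- the row weights are the diagonal of ρ in the basis V -/
lemma row_weight {ρ U V : Matrix n n ℂ} {p : n → ℝ} (h1 : IsDiag ρ U p) (j : n) :
    ∑ i, ‖(Vᴴ * U) j i‖ ^ 2 * p i = ((Vᴴ * ρ * V) j j).re := by
  have : Vᴴ * ρ * V = (Vᴴ * U) * Matrix.diagonal (fun i => (p i : ℂ)) * (Vᴴ * U)ᴴ := by
    rw [h1.eq]; simp [Matrix.mul_assoc]
  rw [this, Matrix.mul_apply, Complex.re_sum]
  refine Finset.sum_congr rfl fun i _ => ?_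
  rw [Matrix.mul_diagonal, Matrix.conjTranspose_apply, mul_right_comm, 
    ← Complex.normSq_eq_norm_sq, Complex.re_mul_ofReal, Complex.normSq_apply]; simp

lemma exists_isDiag {ρ : Matrix n n ℂ} (h : ρ.PosSemidef) :
    ∃ U p, IsDiag ρ U p ∧ (∀ i, 0 ≤ p i) ∧ vnEntropy ρ = - ∑ i, p i * Real.log (p i) := by
  refine ⟨h.1.eigenvectorUnitary, h.1.eigenvalues, ⟨?_, ?_, ?_⟩, h.eigenvalues_nonneg, ?_⟩
  · have := h.1.spectral_theorem
    rw [Unitary.conjStarAlgAut_apply] at this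
    exact this
  · exact Unitary.mul_star_self_of_mem (h.1.eigenvectorUnitary).2
  · exact Unitary.star_mul_self_of_mem (h.1.eigenvectorUnitary).2
  · rw [vnEntropy, dif_pos h.1]

end gen

lemma vnEntropy_charpoly {n m : Type*} [Fintype n] [DecidableEq n] [Fintype m] [DecidableEq m]
    {M : Matrix n n ℂ} {N : Matrix m m ℂ} (hM : M.IsHermitian) (hN : N.IsHermitian)
    (h : M.charpoly = N.charpoly) : vnEntropy M = vnEntropy N := by
  have key : ∀ {k : Type _} [Fintype k] [DecidableEq k] {K : Matrix k k ℂ} (hK : K.IsHermitian),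
      vnEntropy K = -(K.charpoly.roots.map (fun z => z.re * Real.log z.re)).sum := by
    intro k _ _ K hK
    rw [vnEntropy, dif_pos hK, hK.roots_charpoly_eq_eigenvalues]
    simp
  have key' : ∀ {k : Type _} [Fintype k] [DecidableEq k] {K : Matrix k k ℂ} (hK : K.IsHermitian),
      vnEntropy K = -(K.charpoly.roots.map (fun z => z.re * Real.log z.re)).sum := by
    intro k _ _ K hK
    rw [vnEntropy, dif_pos hK, hK.roots_charpoly_eq_eigenvalues]
    simp
  rw [key hM, key' hN, h]

lemma vnEntropy_submatrix {n m : Type*} [Fintype n] [DecidableEq n] [Fintype m] [DecidableEq m]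
    {M : Matrix n n ℂ} (hM : M.IsHermitian) (e : m ≃ n) :
    vnEntropy (M.submatrix e e) = vnEntropy M := by
  refine vnEntropy_charpoly (hM.submatrix e) hM ?_
  have := Matrix.charpoly_reindex e.symm M
  simpa using this

section mono
variable {X Y : Type*} [Fintype X] [DecidableEq X] [Fintype Y] [DecidableEq Y]

noncomputable def tr1 (ρ : Matrix (X × Y) (X × Y) ℂ) : Matrix Y Y ℂ :=
  Matrix.of fun x y => ∑ a : X, ρ (a, x) (a, y)

lemma trace_tr1_mul (ρ : Matrix (X × Y) (X × Y) ℂ) (M : Matrix Y Y ℂ) :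
    (ρ * ((1 : Matrix X X ℂ) ⊗ₖ M)).trace = (tr1 ρ * M).trace := by
  simp only [Matrix.trace, Matrix.diag, Matrix.mul_apply, Fintype.sum_prod_type, tr1,
    Matrix.of_apply, Matrix.kroneckerMap_apply, Matrix.one_apply, ite_mul, one_mul, zero_mul,
    mul_ite, mul_zero, Finset.sum_mul]
  rw [Finset.sum_comm]
  refine Finset.sum_congr rfl fun y _ => ?_
  rw [Finset.sum_comm (s := Finset.univ (α := Y)) (t := Finset.univ (α := X))]
  refine Finset.sum_congr rfl fun x _ => ?_
  rw [Finset.sum_comm]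
  refine Finset.sum_congr rfl fun y' _ => ?_
  simp

lemma trace_tr1 (ρ : Matrix (X × Y) (X × Y) ℂ) : (tr1 ρ).trace = ρ.trace := by
  have := trace_tr1_mul ρ 1
  simpa using this.symm

lemma J_tr1 (t : ℝ) (ρ σ : Matrix (X × Y) (X × Y) ℂ) (Z : Matrix Y Y ℂ) :
    J t ρ σ ((1 : Matrix X X ℂ) ⊗ₖ Z) = J t (tr1 ρ) (tr1 σ) Z := by
  simp only [J, Matrix.conjTranspose_kronecker, ← Matrix.mul_kronecker_mul, Matrix.conjTranspose_one,
    Matrix.one_mul, trace_tr1_mul]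

theorem mono {ρ σ U V : Matrix (X × Y) (X × Y) ℂ} {p q : X × Y → ℝ} {U' V' : Matrix Y Y ℂ}
    {p' q' : Y → ℝ}
    (h1 : IsDiag ρ U p) (h2 : IsDiag σ V q) (h1' : IsDiag (tr1 ρ) U' p') (h2' : IsDiag (tr1 σ) V' q')
    (hp : ∀ i, 0 ≤ p i) (hq : ∀ i, 0 ≤ q i) (hp' : ∀ i, 0 ≤ p' i) (hq' : ∀ i, 0 ≤ q' i)
    (hs : Supp U V p q) (hs' : Supp U' V' p' q') :
    (∑ i, p' i * Real.log (p' i)) - ∑ j, ∑ i, ‖(V'ᴴ * U') j i‖ ^ 2 * p' i * Real.log (q' j) ≤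
    (∑ i, p i * Real.log (p i)) - ∑ j, ∑ i, ‖(Vᴴ * U) j i‖ ^ 2 * p i * Real.log (q j) := by
  have hF : ∀ t : ℝ, 0 < t → F U' V' p' q' t ≤ F U V p q t := by
    intro t ht
    obtain ⟨Z, hZ⟩ := J_attain h1' h2' hp' hq' ht
    rw [← hZ, ← J_tr1]
    exact J_le h1 h2 hp hq ht _
  let h : ℝ → ℝ := fun t => Hs U V p q t - Hs U' V' p' q' t
  have hd : ∀ t : ℝ, 0 < t → HasDerivAt h (F U V p q t - F U' V' p' q' t) t := fun t ht =>
    (Hs_deriv hp hq ht).sub (Hs_deriv hp' hq' ht)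
  have hm : MonotoneOn h (Set.Ioi 0) := by
    refine monotoneOn_of_deriv_nonneg (convex_Ioi 0)
      (fun t ht => (hd t ht).continuousAt.continuousWithinAt) ?_ ?_
    · rw [interior_Ioi]
      exact fun t ht => (hd t ht).differentiableAt.differentiableWithinAt
    · rw [interior_Ioi]
      intro t ht
      rw [(hd t ht).deriv]
      exact sub_nonneg.2 (hF t ht)
  have l0 := (Hs_zero hs).sub (Hs_zero hs')
  have l1 := (Hs_top (U := U) (V := V) hp hq).sub (Hs_top (U := U') (V := V') hp' hq')
  have := le_of_tendsto_of_tendsto l0 l1 (by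
    filter_upwards [eventually_ge_atTop 1] with T hT
    have hT0 : 0 < T := by linarith
    have := hm (Set.mem_Ioi.2 (inv_pos.2 hT0)) (Set.mem_Ioi.2 hT0)
      ((inv_le_one_of_one_le₀ hT).trans hT)
    simp only [h] at this
    rw [sum_p h1 h2, sum_p h1' h2', trace_tr1]
    linarith)
  rw [sum_fp h1 h2, sum_fp h1' h2'] at this
  linarith

end mono

section kron
variable {Y C : Type*} [Fintype Y] [DecidableEq Y] [Fintype C] [DecidableEq C]

/-- trace over second factor -/
noncomputable def tr2 (ρ : Matrix (Y × C) (Y × C) ℂ) : Matrix Y Y ℂ :=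
  Matrix.of fun x y => ∑ c : C, ρ (x, c) (y, c)

lemma diag_tr2 (ρ : Matrix (Y × C) (Y × C) ℂ) (V : Matrix Y Y ℂ) (j : Y) :
    ∑ c, ((V ⊗ₖ (1 : Matrix C C ℂ))ᴴ * ρ * (V ⊗ₖ (1 : Matrix C C ℂ))) (j, c) (j, c)
      = (Vᴴ * tr2 ρ * V) j j := by
  simp only [Matrix.mul_apply, Fintype.sum_prod_type, tr2, Matrix.conjTranspose_kronecker,
    Matrix.conjTranspose_one,
    Matrix.of_apply, Matrix.kroneckerMap_apply, Matrix.one_apply, ite_mul, one_mul, zero_mul,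
    mul_ite, mul_zero, mul_one, Finset.sum_mul, Finset.mul_sum]
  simp
  rw [Finset.sum_comm]
  refine Finset.sum_congr rfl fun y _ => ?_
  rw [Finset.sum_comm]

end kron

section ssa

lemma kron_isDiag {N Y C : Type*} [Fintype N] [DecidableEq N] [Fintype Y] [DecidableEq Y]
    [Fintype C] [DecidableEq C] (e : N ≃ Y × C) {M V : Matrix Y Y ℂ} {q : Y → ℝ}
    (h : IsDiag M V q) :
    IsDiag ((M ⊗ₖ (1 : Matrix C C ℂ)).submatrix e e) ((V ⊗ₖ (1 : Matrix C C ℂ)).submatrix e e)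
      (fun x => q (e x).1) := by
  have hd : Matrix.diagonal (fun x => (q (e x).1 : ℂ)) =
      (Matrix.diagonal (fun i => (q i : ℂ)) ⊗ₖ (1 : Matrix C C ℂ)).submatrix e e := by
    rw [← Matrix.diagonal_one, Matrix.diagonal_kronecker_diagonal,
      Matrix.submatrix_diagonal_equiv]
    congr 1; funext x; simp
  refine ⟨?_, ?_, ?_⟩
  · rw [hd, Matrix.conjTranspose_submatrix, Matrix.submatrix_mul_equiv, Matrix.submatrix_mul_equiv,
      Matrix.conjTranspose_kronecker, ← Matrix.mul_kronecker_mul, ← Matrix.mul_kronecker_mul, ← h.eq]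
    simp
  · rw [Matrix.conjTranspose_submatrix, Matrix.submatrix_mul_equiv,
      Matrix.conjTranspose_kronecker, ← Matrix.mul_kronecker_mul, h.l]
    simp
  · rw [Matrix.conjTranspose_submatrix, Matrix.submatrix_mul_equiv,
      Matrix.conjTranspose_kronecker, ← Matrix.mul_kronecker_mul, h.r]
    simp

lemma kron_weights {N Y C : Type*} [Fintype N] [DecidableEq N] [Fintype Y] [DecidableEq Y]
    [Fintype C] [DecidableEq C] (e : N ≃ Y × C) {M V : Matrix Y Y ℂ} {q : Y → ℝ}
    (h : IsDiag M V q) {ρ U : Matrix N N ℂ} {p : N → ℝ} (h1 : IsDiag ρ U p)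
    (hM : tr2 (ρ.submatrix e.symm e.symm) = M) (j : Y) :
    ∑ c, ∑ i, ‖(((V ⊗ₖ (1 : Matrix C C ℂ)).submatrix e e)ᴴ * U) (e.symm (j, c)) i‖ ^ 2 * p i
      = q j := by
  simp only [row_weight h1]
  have e1 : ((V ⊗ₖ (1 : Matrix C C ℂ)).submatrix e e)ᴴ * ρ * (V ⊗ₖ (1 : Matrix C C ℂ)).submatrix e e
      = ((V ⊗ₖ (1 : Matrix C C ℂ))ᴴ * ρ.submatrix e.symm e.symm * (V ⊗ₖ (1 : Matrix C C ℂ))).submatrix e e := by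
    have : ρ = (ρ.submatrix e.symm e.symm).submatrix e e := by ext; simp
    conv_lhs => rw [this]
    rw [Matrix.conjTranspose_submatrix, Matrix.submatrix_mul_equiv, Matrix.submatrix_mul_equiv]
  rw [e1]
  simp only [Matrix.submatrix_apply, Equiv.apply_symm_apply]
  rw [← Complex.re_sum, diag_tr2, hM, h.eq]
  have : Vᴴ * (V * Matrix.diagonal (fun i => (q i : ℂ)) * Vᴴ) * V
      = (Vᴴ * V) * Matrix.diagonal (fun i => (q i : ℂ)) * (Vᴴ * V) := by simp only [Matrix.mul_assoc]
  rw [this, h.r]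
  simp

lemma kron_supp {N Y C : Type*} [Fintype N] [DecidableEq N] [Fintype Y] [DecidableEq Y]
    [Fintype C] [DecidableEq C] (e : N ≃ Y × C) {M V : Matrix Y Y ℂ} {q : Y → ℝ}
    (h : IsDiag M V q) {ρ U : Matrix N N ℂ} {p : N → ℝ} (h1 : IsDiag ρ U p) (hp : ∀ i, 0 ≤ p i)
    (hM : tr2 (ρ.submatrix e.symm e.symm) = M) :
    Supp U ((V ⊗ₖ (1 : Matrix C C ℂ)).submatrix e e) p (fun x => q (e x).1) := by
  intro x i hx
  have hw := kron_weights e h h1 hM (e x).1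
  replace hx : q (e x).1 = 0 := hx
  rw [hx] at hw
  have nn : ∀ y i, 0 ≤ ‖(((V ⊗ₖ (1 : Matrix C C ℂ)).submatrix e e)ᴴ * U) y i‖ ^ 2 * p i :=
    fun y i => mul_nonneg (sq_nonneg _) (hp i)
  rw [Finset.sum_eq_zero_iff_of_nonneg (fun c _ => Finset.sum_nonneg fun i _ => nn _ i)] at hw
  have h2 := hw (e x).2 (Finset.mem_univ _)
  rw [Finset.sum_eq_zero_iff_of_nonneg (fun i _ => nn _ i)] at h2
  simpa using h2 i (Finset.mem_univ _)

lemma kron_log {N Y C : Type*} [Fintype N] [DecidableEq N] [Fintype Y] [DecidableEq Y]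
    [Fintype C] [DecidableEq C] (e : N ≃ Y × C) {M V : Matrix Y Y ℂ} {q : Y → ℝ}
    (h : IsDiag M V q) {ρ U : Matrix N N ℂ} {p : N → ℝ} (h1 : IsDiag ρ U p)
    (hM : tr2 (ρ.submatrix e.symm e.symm) = M) :
    ∑ x, ∑ i, ‖(((V ⊗ₖ (1 : Matrix C C ℂ)).submatrix e e)ᴴ * U) x i‖ ^ 2 * p i
      * Real.log (q (e x).1) = ∑ j, q j * Real.log (q j) := by
  rw [← e.symm.sum_comp, Fintype.sum_prod_type]
  refine Finset.sum_congr rfl fun j _ => ?_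
  simp only [Equiv.apply_symm_apply, ← Finset.sum_mul]
  rw [kron_weights e h h1 hM]

variable {A B C : Type*} [Fintype A] [DecidableEq A] [Fintype B] [DecidableEq B]
  [Fintype C] [DecidableEq C]

lemma psd_redAB {ρ : Matrix (A × B × C) (A × B × C) ℂ} (h : ρ.PosSemidef) :
    (redAB ρ).PosSemidef := by
  have : redAB ρ = ∑ c : C, ρ.submatrix (fun x : A × B => (x.1, x.2, c)) (fun x => (x.1, x.2, c)) := by
    ext x y; simp [redAB, Matrix.sum_apply]
  rw [this]
  exact Matrix.posSemidef_sum _ fun c _ => h.submatrix _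

lemma psd_redBC {ρ : Matrix (A × B × C) (A × B × C) ℂ} (h : ρ.PosSemidef) :
    (redBC ρ).PosSemidef := by
  have : redBC ρ = ∑ a : A, ρ.submatrix (fun x : B × C => (a, x.1, x.2)) (fun x => (a, x.1, x.2)) := by
    ext x y; simp [redBC, Matrix.sum_apply]
  rw [this]
  exact Matrix.posSemidef_sum _ fun c _ => h.submatrix _

lemma psd_redB {ρ : Matrix (A × B × C) (A × B × C) ℂ} (h : ρ.PosSemidef) :
    (redB ρ).PosSemidef := by
  have : redB ρ = ∑ a : A, ∑ c : C, ρ.submatrix (fun x : B => (a, x, c)) (fun x => (a, x, c)) := by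
    ext x y; simp [redB, Matrix.sum_apply]
  rw [this]
  exact Matrix.posSemidef_sum _ fun a _ => Matrix.posSemidef_sum _ fun c _ => h.submatrix _

/-- Strong subadditivity. -/
theorem CMI_nonneg {ρ : Matrix (A × B × C) (A × B × C) ℂ} (h : ρ.PosSemidef) : 0 ≤ CMI ρ := by
  obtain ⟨U, p, h1, hp, S1⟩ := exists_isDiag h
  obtain ⟨V, q, h2, hq, S2⟩ := exists_isDiag (psd_redAB h)
  obtain ⟨U', p', h1', hp', S1'⟩ := exists_isDiag (psd_redBC h)
  obtain ⟨V', q', h2', hq', S2'⟩ := exists_isDiag (psd_redB h)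
  let e := (Equiv.prodAssoc A B C).symm
  let e' := Equiv.refl (B × C)
  have t1 : tr2 (ρ.submatrix e.symm e.symm) = redAB ρ := by
    ext x y; simp [tr2, redAB, e]
  have t2 : tr2 ((redBC ρ).submatrix e'.symm e'.symm) = redB ρ := by
    ext x y; simp [tr2, redBC, redB, e']; rw [Finset.sum_comm]
  have t3 : tr1 ρ = redBC ρ := by
    ext x y; simp [tr1, redBC]
  have t4 : tr1 ((redAB ρ ⊗ₖ (1 : Matrix C C ℂ)).submatrix e e)
      = (redB ρ ⊗ₖ (1 : Matrix C C ℂ)).submatrix e' e' := by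
    ext x y
    simp only [tr1, redAB, redB, e, e', Matrix.of_apply, Matrix.submatrix_apply,
      Matrix.kroneckerMap_apply, Finset.sum_mul]
    rfl
  have k1 := kron_isDiag e (C := C) h2
  have k2 := kron_isDiag e' (C := C) h2'
  have key := mono h1 k1 (t3 ▸ h1') (t4 ▸ k2) hp (fun x => hq _) hp' (fun x => hq' _)
    (kron_supp e h2 h1 hp t1) (kron_supp e' h2' h1' hp' t2)
  rw [kron_log e h2 h1 t1, kron_log e' h2' h1' t2] at key
  rw [CMI, S1, S2, S1', S2']
  linarith

end ssa

section final
variable {A A' B C E : Type*} [Fintype A] [DecidableEq A]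
    [Fintype A'] [DecidableEq A'] [Fintype B] [DecidableEq B]
    [Fintype C] [DecidableEq C] [Fintype E] [DecidableEq E]

lemma psd_ptraceE {ρ : Matrix (A × B × C × E) (A × B × C × E) ℂ} (h : ρ.PosSemidef) :
    (ptraceE ρ).PosSemidef := by
  have : ptraceE ρ = ∑ c : E, ρ.submatrix (fun x : A × B × C => (x.1, x.2.1, x.2.2, c))
      (fun x => (x.1, x.2.1, x.2.2, c)) := by
    ext x y; simp [ptraceE, Matrix.sum_apply]
  rw [this]
  exact Matrix.posSemidef_sum _ fun c _ => h.submatrix _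

lemma density_ptraceA' {ρ : Matrix ((A × A') × B × C × E) ((A × A') × B × C × E) ℂ}
    (h : IsDensity ρ) : IsDensity (ptraceA' ρ) := by
  constructor
  · have : ptraceA' ρ = ∑ a : A', ρ.submatrix (fun x : A × B × C × E => ((x.1, a), x.2))
        (fun x => ((x.1, a), x.2)) := by
      ext x y; simp [ptraceA', Matrix.sum_apply]
    rw [this]
    exact Matrix.posSemidef_sum _ fun c _ => h.1.submatrix _
  · rw [← h.2]
    simp only [Matrix.trace, Matrix.diag, ptraceA', Matrix.of_apply]
    rw [Fintype.sum_prod_type, Fintype.sum_prod_type, Fintype.sum_prod_type]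
    exact Finset.sum_congr rfl fun a _ => Finset.sum_comm

/-- regrouping -/
def regroup (A A' B C : Type*) : A' × (A × B) × C ≃ (A × A') × B × C where
  toFun x := ((x.2.1.1, x.1), x.2.1.2, x.2.2)
  invFun x := (x.1.2, (x.1.1, x.2.1), x.2.2)
  left_inv _ := rfl
  right_inv _ := rfl

def regroup2 (A A' B : Type*) : A' × (A × B) ≃ (A × A') × B where
  toFun x := ((x.2.1, x.1), x.2.2)
  invFun x := (x.1.2, (x.1.1, x.2))
  left_inv _ := rfl
  right_inv _ := rfl

lemma CMI_mono {τ : Matrix ((A × A') × B × C × E) ((A × A') × B × C × E) ℂ}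
    (h : IsDensity τ) : CMI (ptraceE (ptraceA' τ)) ≤ CMI (ptraceE τ) := by
  have hρ := psd_ptraceE h.1
  have hμ := psd_ptraceE (density_ptraceA' h).1
  set ρ := ptraceE τ with hρd
  set μ := ptraceE (ptraceA' τ) with hμd
  have hμρ : ∀ x y, μ x y = ∑ a', ρ ((x.1, a'), x.2) ((y.1, a'), y.2) := by
    intro x y
    simp only [hρd, hμd, ptraceE, ptraceA', Matrix.of_apply]
    exact Finset.sum_comm
  have ssa := CMI_nonneg (hρ.submatrix (regroup A A' B C))
  have s1 : vnEntropy (ρ.submatrix (regroup A A' B C) (regroup A A' B C)) = vnEntropy ρ :=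
    vnEntropy_submatrix hρ.1 _
  have s2 : vnEntropy (redAB (ρ.submatrix (regroup A A' B C) (regroup A A' B C)))
      = vnEntropy (redAB ρ) :=
    vnEntropy_submatrix (M := redAB ρ) (psd_redAB hρ).1 (regroup2 A A' B)
  have s3 : vnEntropy (redBC (ρ.submatrix (regroup A A' B C) (regroup A A' B C)))
      = vnEntropy μ := by
    rw [← vnEntropy_submatrix hμ.1 (Equiv.prodAssoc A B C)]
    congr 1
    ext x y
    simp only [Matrix.submatrix_apply, hμρ, redBC, Matrix.of_apply]
    rfl
  have s4 : redB (ρ.submatrix (regroup A A' B C) (regroup A A' B C)) = redAB μ := by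
    ext x y
    simp only [Matrix.submatrix_apply, hμρ, redB, redAB, Matrix.of_apply]
    rw [Finset.sum_comm]
    rfl
  have s5 : redBC μ = redBC ρ := by
    ext x y
    simp only [hμρ, redBC, Matrix.of_apply]
    rw [Fintype.sum_prod_type]
  have s6 : redB μ = redB ρ := by
    ext x y
    simp only [hμρ, redB, Matrix.of_apply]
    rw [Fintype.sum_prod_type]
    exact Finset.sum_congr rfl fun a _ => Finset.sum_comm
  rw [CMI, s1, s2, s3, s4] at ssa
  rw [CMI, CMI, s5, s6]
  linarith

end final
end SSA

/-- monotonicity of the mixed convex roof CMI under tracing out part of A. -/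
theorem mcoCMI_mono_trace_out {A A' B C E : Type*} [Fintype A] [DecidableEq A]
    [Fintype A'] [DecidableEq A'] [Fintype B] [DecidableEq B]
    [Fintype C] [DecidableEq C] [Fintype E] [DecidableEq E]
    (ρ : Matrix ((A × A') × B × C × E) ((A × A') × B × C × E) ℂ) (hρ : IsDensity ρ) :
    mcoCMI (ptraceA' ρ) ≤ mcoCMI ρ := by
  unfold mcoCMI
  refine le_csInf ?_ ?_
  · exact ⟨_, 1, fun _ => 1, fun _ => ρ, by simp, by simp, fun _ => hρ, by simp, rfl⟩
  · rintro r ⟨k, p, τ, hp, hp1, hτ, hsum, rfl⟩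
    refine le_trans (csInf_le ?_ ⟨k, p, fun i => ptraceA' (τ i), hp, hp1,
      fun i => SSA.density_ptraceA' (hτ i), ?_, rfl⟩) ?_
    · refine ⟨0, ?_⟩
      rintro r ⟨k, p, τ, hp, hp1, hτ, hsum, rfl⟩
      exact Finset.sum_nonneg fun i _ =>
        mul_nonneg (hp i) (SSA.CMI_nonneg (SSA.psd_ptraceE (hτ i).1))
    · rw [hsum]
      ext x y
      simp only [ptraceA', Matrix.of_apply, Matrix.sum_apply, Matrix.smul_apply, Finset.smul_sum]
      exact Finset.sum_comm
    · exact Finset.sum_le_sum fun i _ => mul_le_mul_of_nonneg_left (SSA.CMI_mono (hτ i)) (hp i)
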